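/- Let n ∈ ℕ, k ∈ {0,…,n}, Δ ≥ 0, x ∈ k𝔹₀, w ∈ ℝⁿ, and set C := k𝔹₀ ∩ (x + Δ𝔹∞). Let ℓ(x) := {i : |x_i| > Δ}, ŷ_i := max(x_i − Δ, min(w_i, x_i + Δ)), and z_i := w_i² − (w_i − ŷ_i)². For S ⊆ {1,…,n} with |S| = k and ℓ(x) ⊆ S, let y(S) be defined by y(S)_i = ŷ_i for i ∈ S and y(S)_i = 0 for i ∉ S. Then the set P(w) of projections of w into C equals { y(S) : S ⊆ {1,…,n}, |S| = k, ℓ(x) ⊆ S, and Σ_{i∈S} z_i is maximal among all such S }. -/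

import Mathlib

open Finset

noncomputable section

/-- The `ℓ∞` ball of radius `Δ` centered at `x`: `x + Δ𝔹∞`. -/
def box (n : ℕ) (x : Fin n → ℝ) (Δ : ℝ) : Set (Fin n → ℝ) :=
  {y | ∀ i, |y i - x i| ≤ Δ}

/-- The zero-norm ball `k𝔹₀`: vectors with at most `k` nonzero components. -/
def sparse (n k : ℕ) : Set (Fin n → ℝ) :=
  {y | (Finset.univ.filter (fun i => y i ≠ 0)).card ≤ k}

/-- The piece `A_S`: vectors supported in `S`. -/
def AS {n : ℕ} (S : Finset (Fin n)) : Set (Fin n → ℝ) :=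
  {y | ∀ i, i ∉ S → y i = 0}

/-- Squared Euclidean distance. -/
def distSq {n : ℕ} (w y : Fin n → ℝ) : ℝ := ∑ i, (w i - y i) ^ 2

/-- The set of projections (closest points in the Euclidean norm) of `w` into `A`. -/
def projSet {n : ℕ} (w : Fin n → ℝ) (A : Set (Fin n → ℝ)) : Set (Fin n → ℝ) :=
  {y | y ∈ A ∧ ∀ z ∈ A, distSq w y ≤ distSq w z}

/-- Obtuse-angle inequality for the projection of `w` onto the interval `[x - Δ, x + Δ]`. -/
lemma sq_clamp_add_sq_le {x w Δ v : ℝ} (hv : |v - x| ≤ Δ) :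
    (w - max (x - Δ) (min w (x + Δ))) ^ 2 + (v - max (x - Δ) (min w (x + Δ))) ^ 2
      ≤ (w - v) ^ 2 := by
  obtain ⟨h₁, h₂⟩ := abs_le.1 hv
  rcases le_total w (x + Δ) with h | h
  · rw [min_eq_left h]
    rcases le_total (x - Δ) w with h' | h'
    · rw [max_eq_right h']
      nlinarith
    · rw [max_eq_left h']
      nlinarith
  · rw [min_eq_right h, max_eq_right (by linarith)]
    nlinarith

lemma abs_clamp_sub_le {x w Δ : ℝ} (hΔ : 0 ≤ Δ) :
    |max (x - Δ) (min w (x + Δ)) - x| ≤ Δ := by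
  have h₁ := le_max_left (x - Δ) (min w (x + Δ))
  have h₂ : max (x - Δ) (min w (x + Δ)) ≤ x + Δ :=
    max_le (by linarith) (min_le_right _ _)
  exact abs_le.2 ⟨by linarith, by linarith⟩

/-- Squared distance from `w` to the vector equal to `u` on `S` and zero elsewhere. -/
lemma distSq_ite {n : ℕ} (w u : Fin n → ℝ) (S : Finset (Fin n)) :
    distSq w (fun i => if i ∈ S then u i else 0)
      = ∑ i, w i ^ 2 - ∑ i ∈ S, (w i ^ 2 - (w i - u i) ^ 2) := by
  rw [distSq, ← Finset.sum_ite_mem_eq S, ← Finset.sum_sub_distrib]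
  refine Finset.sum_congr rfl fun i _ => ?_
  split_ifs <;> ring

lemma ite_mem_sparse {n k : ℕ} (u : Fin n → ℝ) {S : Finset (Fin n)} (hS : S.card ≤ k) :
    (fun i => if i ∈ S then u i else 0) ∈ sparse n k := by
  refine (Finset.card_le_card fun i hi => ?_).trans hS
  by_contra h
  simp [h] at hi

lemma ite_mem_box {n : ℕ} {x u : Fin n → ℝ} {Δ : ℝ} {S : Finset (Fin n)}
    (hu : u ∈ box n x Δ) (hS : ∀ i, Δ < |x i| → i ∈ S) :
    (fun i => if i ∈ S then u i else 0) ∈ box n x Δ := by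
  intro i
  by_cases h : i ∈ S
  · simpa [h] using hu i
  · simpa [h] using not_lt.1 (mt (hS i) h)

/-- A sparse vector in the box is supported in a set of cardinality exactly `k`, which
necessarily contains every index whose coordinate the box keeps away from zero. -/
lemma exists_support_card_eq {n k : ℕ} (hkn : k ≤ n) {x y : Fin n → ℝ} {Δ : ℝ}
    (hy : y ∈ sparse n k ∩ box n x Δ) :
    ∃ S : Finset (Fin n), S.card = k ∧ (∀ i, Δ < |x i| → i ∈ S) ∧ y ∈ AS S := by
  obtain ⟨S, hsub, hS⟩ := Finset.exists_superset_card_eq hy.1 (by simpa using hkn)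
  have hsupp : y ∈ AS S := fun i hi => by
    by_contra h
    exact hi (hsub (by simpa using h))
  refine ⟨S, hS, fun i hi => ?_, hsupp⟩
  by_contra h
  have := hy.2 i
  rw [hsupp i h, zero_sub, abs_neg] at this
  linarith

/-- `P(w)` is exactly the set of vectors `y(S)` for those `S` of cardinality
`k` containing `ℓ(x) = {i : |x i| > Δ}` that maximize `Σ_{i∈S} z_i`. -/
theorem stmt11 (n k : ℕ) (hkn : k ≤ n) (Δ : ℝ) (hΔ : 0 ≤ Δ)
    (x : Fin n → ℝ) (hx : x ∈ sparse n k) (w : Fin n → ℝ)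
    (yhat z : Fin n → ℝ)
    (hyhat : ∀ i, yhat i = max (x i - Δ) (min (w i) (x i + Δ)))
    (hz : ∀ i, z i = (w i) ^ 2 - (w i - yhat i) ^ 2) :
    projSet w (sparse n k ∩ box n x Δ) =
      {y | ∃ S : Finset (Fin n), S.card = k ∧ (∀ i, Δ < |x i| → i ∈ S) ∧
        (∀ T : Finset (Fin n), T.card = k → (∀ i, Δ < |x i| → i ∈ T) →
          ∑ i ∈ T, z i ≤ ∑ i ∈ S, z i) ∧
        ∀ i, y i = if i ∈ S then yhat i else 0} := by
  have hbox : yhat ∈ box n x Δ := fun i => by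
    rw [hyhat]
    exact abs_clamp_sub_le hΔ
  have hdist (S : Finset (Fin n)) :
      distSq w (fun i => if i ∈ S then yhat i else 0) = ∑ i, w i ^ 2 - ∑ i ∈ S, z i := by
    simp only [distSq_ite, hz]
  have hmem (S : Finset (Fin n)) (hS : S.card = k) (hl : ∀ i, Δ < |x i| → i ∈ S) :
      (fun i => if i ∈ S then yhat i else 0) ∈ sparse n k ∩ box n x Δ :=
    ⟨ite_mem_sparse yhat hS.le, ite_mem_box hbox hl⟩
  have hobtuse (S : Finset (Fin n)) (v : Fin n → ℝ) (hv : v ∈ box n x Δ) (hvS : v ∈ AS S) :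
      distSq w (fun i => if i ∈ S then yhat i else 0)
        + ∑ i, (v i - if i ∈ S then yhat i else 0) ^ 2 ≤ distSq w v := by
    rw [distSq, distSq, ← Finset.sum_add_distrib]
    refine Finset.sum_le_sum fun i _ => ?_
    by_cases h : i ∈ S
    · simpa [h, hyhat i] using sq_clamp_add_sq_le (w := w i) (hv i)
    · simp [h, hvS i h]
  ext y
  constructor
  · rintro ⟨hy, hmin⟩
    obtain ⟨S, hS, hl, hyS⟩ := exists_support_card_eq hkn hy
    have hzero : ∑ i, (y i - if i ∈ S then yhat i else 0) ^ 2 = 0 :=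
      le_antisymm (by linarith [hobtuse S y hy.2 hyS, hmin _ (hmem S hS hl)])
        (Finset.sum_nonneg fun i _ => sq_nonneg _)
    have hyeq (i : Fin n) : y i = if i ∈ S then yhat i else 0 :=
      sub_eq_zero.1 <| pow_eq_zero_iff two_ne_zero |>.1 <|
        (Finset.sum_eq_zero_iff_of_nonneg fun i _ => sq_nonneg _).1 hzero i (Finset.mem_univ i)
    refine ⟨S, hS, hl, fun T hT hlT => ?_, hyeq⟩
    have h := hmin _ (hmem T hT hlT)
    rw [funext hyeq, hdist, hdist] at h
    linarith
  · rintro ⟨S, hS, hl, hmax, hyeq⟩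
    rw [funext hyeq]
    refine ⟨hmem S hS hl, fun v hv => ?_⟩
    obtain ⟨T, hT, hlT, hvT⟩ := exists_support_card_eq hkn hv
    have hnonneg : 0 ≤ ∑ i, (v i - if i ∈ T then yhat i else 0) ^ 2 :=
      Finset.sum_nonneg fun i _ => sq_nonneg _
    have h := hobtuse T v hv.2 hvT
    rw [hdist] at h ⊢
    linarith [hmax T hT hlT]
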